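/- Let n ≥ 1 be an integer and σ > 0 a real number. Define F(x) = cos²(nx/2) + ( sin(nx/2) + (√σ/n)·cos(nx/2) )², μₙ(x) = σ + 2(n² + σ)/F(x) − 3n²/F(x)², ψ₁(x) = e^{√σ·x/2}·F(x)^{−1/2}·√(n/2)·( (√σ/n²)·cos(nx/2) + (2/n)·sin(nx/2) ), and ψ₂(x) = e^{−√σ·x/2}·F(x)^{−1/2}·√(2/n)·cos(nx/2). Then: (i) F(x) > 0 for all x and μₙ is smooth and 2π-periodic; (ii) ψ₁ and ψ₂ solve ψ'' = (μₙ/4)·ψ; (iii) ψ₁'(x)ψ₂(x) − ψ₂'(x)ψ₁(x) = 1 for all x; (iv) ψ₁(x + 2π) = (−1)ⁿ·e^{√σ·π}·ψ₁(x) and ψ₂(x + 2π) = (−1)ⁿ·e^{−√σ·π}·ψ₂(x) for all x, so the monodromy matrix of (ψ₁, ψ₂) is (−1)ⁿ·diag(e^{√σ·π}, e^{−√σ·π}); (v) (1/(2π)) ∫₀^{2π} μₙ(x) dx = 3σ/2 − n². -/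

import Mathlib

open Real Matrix

/-- The derivative of `e^{κ x} g / √F`. -/
lemma hasDerivAt_exp_div_sqrt_mul {κ x F' g' : ℝ} {F g : ℝ → ℝ} (hpos : 0 < F x)
    (hF : HasDerivAt F F' x) (hg : HasDerivAt g g' x) :
    HasDerivAt (fun y => Real.exp (κ * y) / Real.sqrt (F y) * g y)
      (Real.exp (κ * x) / Real.sqrt (F x) * (κ * g x + g' - F' / (2 * F x) * g x)) x := by
  have hs : Real.sqrt (F x) ≠ 0 := (Real.sqrt_pos.2 hpos).ne'
  have hsq : Real.sqrt (F x) ^ 2 = F x := Real.sq_sqrt hpos.le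
  have hE : HasDerivAt (fun y : ℝ => Real.exp (κ * y)) (Real.exp (κ * x) * κ) x := by
    simpa using ((hasDerivAt_id x).const_mul κ).exp
  refine ((hE.div (hF.sqrt hpos.ne') hs).mul hg).congr_deriv ?_
  simp only [Pi.div_apply]
  rw [← hsq, Real.sqrt_sq (Real.sqrt_nonneg _)]
  field_simp
  ring

/-- The second derivative of `e^{κ x} g / √F`. -/
lemma deriv_deriv_exp_div_sqrt_mul {κ : ℝ} {F F' F'' g g' g'' : ℝ → ℝ} (hpos : ∀ x, 0 < F x)
    (hF : ∀ x, HasDerivAt F (F' x) x) (hF' : ∀ x, HasDerivAt F' (F'' x) x)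
    (hg : ∀ x, HasDerivAt g (g' x) x) (hg' : ∀ x, HasDerivAt g' (g'' x) x) (x : ℝ) :
    deriv (deriv fun y => Real.exp (κ * y) / Real.sqrt (F y) * g y) x =
      Real.exp (κ * x) / Real.sqrt (F x) *
        (κ ^ 2 * g x + 2 * κ * g' x + g'' x - F' x / F x * (κ * g x + g' x) +
          g x * (3 * F' x ^ 2 / (4 * F x ^ 2) - F'' x / (2 * F x))) := by
  have h1 : (deriv fun y => Real.exp (κ * y) / Real.sqrt (F y) * g y) = fun y =>
      Real.exp (κ * y) / Real.sqrt (F y) * (κ * g y + g' y - F' y / (2 * F y) * g y) :=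
    funext fun y => (hasDerivAt_exp_div_sqrt_mul (hpos y) (hF y) (hg y)).deriv
  have hne := (hpos x).ne'
  have h2 : HasDerivAt (fun y => F' y / (2 * F y)) _ x :=
    (hF' x).div ((hF x).const_mul 2) (by positivity)
  have h3 : HasDerivAt (fun y => κ * g y + g' y - F' y / (2 * F y) * g y) _ x :=
    (((hg x).const_mul κ).add (hg' x)).sub (h2.mul (hg x))
  rw [h1, (hasDerivAt_exp_div_sqrt_mul (hpos x) (hF x) h3).deriv]
  congr 1
  field_simp
  ring

/-- The derivative of the imaginary part of the logarithm along a curve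
in the slit plane. -/
lemma hasDerivAt_im_log {u v : ℝ → ℝ} {u' v' x : ℝ} (hu : HasDerivAt u u' x)
    (hv : HasDerivAt v v' x) (h : (u x + v x * Complex.I : ℂ) ∈ Complex.slitPlane) :
    HasDerivAt (fun y => (Complex.log (u y + v y * Complex.I)).im)
      ((v' * u x - u' * v x) / (u x ^ 2 + v x ^ 2)) x := by
  have hz : HasDerivAt (fun y => (u y + v y * Complex.I : ℂ)) (u' + v' * Complex.I) x :=
    hu.ofReal_comp.add (hv.ofReal_comp.mul_const _)
  refine (Complex.imCLM.hasFDerivAt.comp_hasDerivAt x (hz.clog_real h)).congr_deriv ?_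
  simp [Complex.div_im, Complex.normSq_apply]
  ring

/-- The algebraic form of the Hill equation for `e^{κ x} g / √f`, where `p` stands for `f'` and
`g'' = -(n² / 4) g`. -/
lemma hill_algebra {n a κ f p g g' : ℝ} (hf : f ≠ 0)
    (hp : p ^ 2 = n ^ 2 * ((2 + a ^ 2) * f - 1 - f ^ 2)) (hκ : κ ^ 2 = (n * a) ^ 2 / 4)
    (h : f * (2 * κ * g' - n ^ 2 / 2 * g) - p * (κ * g + g') + n ^ 2 / 2 * g = 0) :
    κ ^ 2 * g + 2 * κ * g' + -(n ^ 2 / 4 * g) - p / f * (κ * g + g') +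
      g * (3 * p ^ 2 / (4 * f ^ 2) - n ^ 2 * (1 + a ^ 2 / 2 - f) / (2 * f)) =
    ((n * a) ^ 2 + 2 * (n ^ 2 + (n * a) ^ 2) / f - 3 * n ^ 2 / f ^ 2) / 4 * g := by
  rw [hp, hκ]
  field_simp
  linear_combination 16 * f * h

/-- `F'² = n² ((2 + a²) F - 1 - F²)` in terms of `c = cos (n x / 2)` and `S = sin (n x / 2)`. -/
lemma sq_identity {n a c S : ℝ} (h : c ^ 2 + S ^ 2 = 1) :
    (n * (a * (c ^ 2 - S ^ 2) - a ^ 2 * c * S)) ^ 2 =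
      n ^ 2 * ((2 + a ^ 2) * (c ^ 2 + (S + a * c) ^ 2) - 1 - (c ^ 2 + (S + a * c) ^ 2) ^ 2) := by
  have h' : S ^ 2 = 1 - c ^ 2 := by linarith
  grind

/-- The hypothesis of `hill_algebra` for the solution growing over a period. -/
lemma expanding_identity {n a c S K : ℝ} (hn : n ≠ 0) (h : c ^ 2 + S ^ 2 = 1) :
    (c ^ 2 + (S + a * c) ^ 2) * (2 * (n * a / 2) * (K * (c - a / 2 * S)) -
      n ^ 2 / 2 * (K * (a / n * c + 2 / n * S))) -
    n * (a * (c ^ 2 - S ^ 2) - a ^ 2 * c * S) *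
      (n * a / 2 * (K * (a / n * c + 2 / n * S)) + K * (c - a / 2 * S)) +
    n ^ 2 / 2 * (K * (a / n * c + 2 / n * S)) = 0 := by
  have h' : S ^ 2 = 1 - c ^ 2 := by linarith
  field_simp
  grind

/-- The hypothesis of `hill_algebra` for the solution decaying over a period. -/
lemma contracting_identity {n a c S K : ℝ} (h : c ^ 2 + S ^ 2 = 1) :
    (c ^ 2 + (S + a * c) ^ 2) * (2 * -(n * a / 2) * (K * -(n / 2 * S)) -
      n ^ 2 / 2 * (K * c)) -
    n * (a * (c ^ 2 - S ^ 2) - a ^ 2 * c * S) *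
      (-(n * a / 2) * (K * c) + K * -(n / 2 * S)) +
    n ^ 2 / 2 * (K * c) = 0 := by
  have h' : S ^ 2 = 1 - c ^ 2 := by linarith
  grind

/-- The numerator of the angular velocity of the curve `(1 + a c S, a c²)`. -/
lemma angular_identity {n a c S : ℝ} (h : c ^ 2 + S ^ 2 = 1) :
    -(n * a * c * S) * (1 + a * c * S) - n / 2 * a * (c ^ 2 - S ^ 2) * (a * c ^ 2) =
      n / 2 * (1 - (c ^ 2 + (S + a * c) ^ 2)) := by
  have h' : S ^ 2 = 1 - c ^ 2 := by linarith
  grind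


/-- Properties of the canonical hyperbolic-type (`𝓗ₙ`) mass-aspect functions
`μₙ` and their Wronskian-normalized Hill functions `(ψ₁, ψ₂)`:
positivity of `F`, smoothness and periodicity of `μₙ`, the Hill equations,
the Wronskian normalization, the monodromy relations giving
`M = (−1)ⁿ diag(e^{√σ π}, e^{−√σ π})`, and the value of the Hamiltonian
mass `(1/(2π)) ∫₀^{2π} μₙ = 3σ/2 − n²`. -/
theorem hyperbolic_type_canonical (n : ℕ) (hn : 1 ≤ n) (σ : ℝ) (hσ : 0 < σ)
    (F μn ψ₁ ψ₂ : ℝ → ℝ)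
    (hF : ∀ x, F x = Real.cos ((n : ℝ) * x / 2) ^ 2 +
        (Real.sin ((n : ℝ) * x / 2) +
          (Real.sqrt σ / n) * Real.cos ((n : ℝ) * x / 2)) ^ 2)
    (hμn : ∀ x, μn x = σ + 2 * ((n : ℝ) ^ 2 + σ) / F x - 3 * (n : ℝ) ^ 2 / F x ^ 2)
    (hψ₁ : ∀ x, ψ₁ x = Real.exp (Real.sqrt σ * x / 2) / Real.sqrt (F x) *
        (Real.sqrt ((n : ℝ) / 2) *
          ((Real.sqrt σ / (n : ℝ) ^ 2) * Real.cos ((n : ℝ) * x / 2) +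
            (2 / n) * Real.sin ((n : ℝ) * x / 2))))
    (hψ₂ : ∀ x, ψ₂ x = Real.exp (-(Real.sqrt σ * x / 2)) / Real.sqrt (F x) *
        (Real.sqrt (2 / (n : ℝ)) * Real.cos ((n : ℝ) * x / 2))) :
    (∀ x, 0 < F x) ∧ ContDiff ℝ (⊤ : ℕ∞) μn ∧ Function.Periodic μn (2 * π) ∧
      (∀ x, deriv (deriv ψ₁) x = μn x / 4 * ψ₁ x) ∧
      (∀ x, deriv (deriv ψ₂) x = μn x / 4 * ψ₂ x) ∧
      (∀ x, deriv ψ₁ x * ψ₂ x - deriv ψ₂ x * ψ₁ x = 1) ∧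
      (∀ x, ψ₁ (x + 2 * π) = (-1 : ℝ) ^ n * Real.exp (Real.sqrt σ * π) * ψ₁ x) ∧
      (∀ x, ψ₂ (x + 2 * π) = (-1 : ℝ) ^ n * Real.exp (-(Real.sqrt σ * π)) * ψ₂ x) ∧
      (1 / (2 * π)) * (∫ x in (0:ℝ)..(2 * π), μn x) = 3 * σ / 2 - (n : ℝ) ^ 2 := by
  have hn0 : (n : ℝ) ≠ 0 := by positivity
  obtain ⟨a, ha⟩ : ∃ a, a = Real.sqrt σ / n := ⟨_, rfl⟩
  have hs : Real.sqrt σ = n * a := by rw [ha]; field_simp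
  have hσa : σ = (n * a) ^ 2 := by rw [← hs, Real.sq_sqrt hσ.le]
  have ha0 : 0 < a := by rw [ha]; positivity
  have hc : ∀ x, HasDerivAt (fun y : ℝ => Real.cos (n * y / 2))
      (-(n / 2 * Real.sin (n * x / 2))) x := fun x => by
    refine ((((hasDerivAt_id x).const_mul (n : ℝ)).div_const 2).cos).congr_deriv ?_
    simp; ring
  have hS : ∀ x, HasDerivAt (fun y : ℝ => Real.sin (n * y / 2))
      (n / 2 * Real.cos (n * x / 2)) x := fun x => by
    refine ((((hasDerivAt_id x).const_mul (n : ℝ)).div_const 2).sin).congr_deriv ?_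
    simp; ring
  have hcs : ∀ x : ℝ, Real.cos (n * x / 2) ^ 2 + Real.sin (n * x / 2) ^ 2 = 1 :=
    fun x => Real.cos_sq_add_sin_sq _
  rw [← ha] at hF
  have hpos : ∀ x, 0 < F x := fun x => by
    rw [hF]
    rcases eq_or_ne (Real.cos (n * x / 2)) 0 with h | h
    · have := hcs x
      rw [h] at this ⊢
      nlinarith
    · positivity
  have hF1 : ∀ x, HasDerivAt F (n * (a * (Real.cos (n * x / 2) ^ 2 - Real.sin (n * x / 2) ^ 2)
      - a ^ 2 * Real.cos (n * x / 2) * Real.sin (n * x / 2))) x := fun x => by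
    rw [funext hF]
    refine (((hc x).pow 2).add (((hS x).add ((hc x).const_mul a)).pow 2)).congr_deriv ?_
    simp; ring
  have hF2 : ∀ x, HasDerivAt (fun x => n * (a * (Real.cos (n * x / 2) ^ 2 -
      Real.sin (n * x / 2) ^ 2) - a ^ 2 * Real.cos (n * x / 2) * Real.sin (n * x / 2)))
      (n ^ 2 * (1 + a ^ 2 / 2 - F x)) x := fun x => by
    refine ((((((hc x).pow 2).sub ((hS x).pow 2)).const_mul a).sub
      (((hc x).const_mul (a ^ 2)).mul (hS x))).const_mul (n : ℝ)).congr_deriv ?_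
    rw [hF]
    simp
    linear_combination ((n : ℝ) ^ 2 * (1 + a ^ 2 / 2)) * hcs x
  have hcosper : ∀ x : ℝ, Real.cos (n * (x + 2 * π) / 2) = (-1) ^ n * Real.cos (n * x / 2) :=
    fun x => by
      rw [← Real.cos_add_nat_mul_pi]; congr 1; ring
  have hsinper : ∀ x : ℝ, Real.sin (n * (x + 2 * π) / 2) = (-1) ^ n * Real.sin (n * x / 2) :=
    fun x => by
      rw [← Real.sin_add_nat_mul_pi]; congr 1; ring
  have hsign : ((-1 : ℝ) ^ n) ^ 2 = 1 := by rw [← pow_mul, mul_comm, pow_mul]; simp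
  have hFper : ∀ x, F (x + 2 * π) = F x := fun x => by
    rw [hF, hF, hcosper, hsinper]
    linear_combination (Real.cos (n * x / 2) ^ 2 +
      (Real.sin (n * x / 2) + a * Real.cos (n * x / 2)) ^ 2) * hsign
  have hE1 : ψ₁ = fun y => Real.exp (n * a / 2 * y) / Real.sqrt (F y) *
      (Real.sqrt ((n : ℝ) / 2) * (a / n * Real.cos (n * y / 2) + 2 / n * Real.sin (n * y / 2))) :=
    funext fun y => by
      rw [hψ₁, hs, show (n : ℝ) * a * y / 2 = n * a / 2 * y by ring,
        show (n : ℝ) * a / n ^ 2 = a / n by field_simp]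
  have hE2 : ψ₂ = fun y => Real.exp (-(n * a / 2) * y) / Real.sqrt (F y) *
      (Real.sqrt (2 / (n : ℝ)) * Real.cos (n * y / 2)) :=
    funext fun y => by
      rw [hψ₂, hs, show -((n : ℝ) * a * y / 2) = -(n * a / 2) * y by ring]
  have hg1 : ∀ x, HasDerivAt (fun y : ℝ => Real.sqrt ((n : ℝ) / 2) *
      (a / n * Real.cos (n * y / 2) + 2 / n * Real.sin (n * y / 2)))
      (Real.sqrt ((n : ℝ) / 2) * (Real.cos (n * x / 2) - a / 2 * Real.sin (n * x / 2))) x :=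
    fun x => by
      refine ((((hc x).const_mul (a / n)).add ((hS x).const_mul (2 / (n : ℝ)))).const_mul
        (Real.sqrt ((n : ℝ) / 2))).congr_deriv ?_
      field_simp
      ring
  have hg1' : ∀ x, HasDerivAt (fun y : ℝ => Real.sqrt ((n : ℝ) / 2) *
      (Real.cos (n * y / 2) - a / 2 * Real.sin (n * y / 2)))
      (-(n ^ 2 / 4 * (Real.sqrt ((n : ℝ) / 2) *
        (a / n * Real.cos (n * x / 2) + 2 / n * Real.sin (n * x / 2))))) x :=
    fun x => by
      refine (((hc x).sub ((hS x).const_mul (a / 2))).const_mul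
        (Real.sqrt ((n : ℝ) / 2))).congr_deriv ?_
      field_simp
      ring
  have hg2 : ∀ x, HasDerivAt (fun y : ℝ => Real.sqrt (2 / (n : ℝ)) * Real.cos (n * y / 2))
      (Real.sqrt (2 / (n : ℝ)) * -(n / 2 * Real.sin (n * x / 2))) x :=
    fun x => (hc x).const_mul _
  have hg2' : ∀ x, HasDerivAt (fun y : ℝ => Real.sqrt (2 / (n : ℝ)) *
      -(n / 2 * Real.sin (n * y / 2)))
      (-(n ^ 2 / 4 * (Real.sqrt (2 / (n : ℝ)) * Real.cos (n * x / 2)))) x :=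
    fun x => ((((hS x).const_mul _).neg).const_mul _).congr_deriv (by ring)
  have hFsmooth : ContDiff ℝ (⊤ : ℕ∞) F := by
    rw [funext hF]; fun_prop
  have hμsmooth : ContDiff ℝ (⊤ : ℕ∞) μn := by
    rw [funext hμn]
    exact (contDiff_const.add (contDiff_const.div hFsmooth fun x => (hpos x).ne')).sub
      (contDiff_const.div (hFsmooth.pow 2) fun x => (pow_pos (hpos x) 2).ne')
  have hF1sq : ∀ x, (n * (a * (Real.cos (n * x / 2) ^ 2 - Real.sin (n * x / 2) ^ 2)
      - a ^ 2 * Real.cos (n * x / 2) * Real.sin (n * x / 2))) ^ 2 =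
      n ^ 2 * ((2 + a ^ 2) * F x - 1 - F x ^ 2) := fun x => by
    rw [hF, sq_identity (hcs x)]
  refine ⟨hpos, hμsmooth, fun x => by rw [hμn, hμn, hFper], fun x => ?_, fun x => ?_, fun x => ?_,
    fun x => ?_, fun x => ?_, ?_⟩
  · have key := hill_algebra (hpos x).ne' (hF1sq x) (κ := n * a / 2) (by ring)
      ((hF x).symm ▸ expanding_identity (K := Real.sqrt ((n : ℝ) / 2)) hn0 (hcs x))
    rw [hE1, deriv_deriv_exp_div_sqrt_mul hpos hF1 hF2 hg1 hg1' x, hμn, hσa]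
    exact (congrArg _ key).trans (mul_left_comm _ _ _)
  · have key := hill_algebra (hpos x).ne' (hF1sq x) (κ := -(n * a / 2)) (by ring)
      ((hF x).symm ▸ contracting_identity (K := Real.sqrt (2 / (n : ℝ))) (hcs x))
    rw [hE2, deriv_deriv_exp_div_sqrt_mul hpos hF1 hF2 hg2 hg2' x, hμn, hσa]
    exact (congrArg _ key).trans (mul_left_comm _ _ _)
  · have hne := (hpos x).ne'
    have hq : Real.sqrt (F x) ^ 2 = F x := Real.sq_sqrt (hpos x).le
    have hK : Real.sqrt ((n : ℝ) / 2) * Real.sqrt (2 / (n : ℝ)) = 1 := by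
      rw [← Real.sqrt_mul (by positivity)]
      simp [hn0]
    have hexp : Real.exp (n * a / 2 * x) * Real.exp (-(n * a / 2) * x) = 1 := by
      rw [← Real.exp_add]
      simp
    have hprod : (Real.exp (n * a / 2 * x) / Real.sqrt (F x)) *
        (Real.exp (-(n * a / 2) * x) / Real.sqrt (F x)) = 1 / F x := by
      rw [div_mul_div_comm, hexp, ← sq, hq]
    rw [hE1, hE2, (hasDerivAt_exp_div_sqrt_mul (hpos x) (hF1 x) (hg1 x)).deriv,
      (hasDerivAt_exp_div_sqrt_mul (hpos x) (hF1 x) (hg2 x)).deriv]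
    have hnum : (n * a * Real.cos (n * x / 2) *
        (a / n * Real.cos (n * x / 2) + 2 / n * Real.sin (n * x / 2)) +
        (Real.cos (n * x / 2) - a / 2 * Real.sin (n * x / 2)) * Real.cos (n * x / 2) +
        n / 2 * Real.sin (n * x / 2) *
        (a / n * Real.cos (n * x / 2) + 2 / n * Real.sin (n * x / 2))) = F x := by
      field_simp
      rw [hF]
      ring
    beta_reduce
    generalize a / n * Real.cos (n * x / 2) + 2 / n * Real.sin (n * x / 2) = g at *
    generalize Real.exp (n * a / 2 * x) / Real.sqrt (F x) = E₁ at *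
    generalize Real.exp (-(n * a / 2) * x) / Real.sqrt (F x) = E₂ at *
    rw [eq_div_iff hne, ← hnum] at hprod
    linear_combination E₁ * E₂ * (n * a * Real.cos (n * x / 2) * g +
      (Real.cos (n * x / 2) - a / 2 * Real.sin (n * x / 2)) * Real.cos (n * x / 2) +
      n / 2 * Real.sin (n * x / 2) * g) * hK + hprod
  · rw [hψ₁, hψ₁, hFper, hcosper, hsinper,
      show Real.sqrt σ * (x + 2 * π) / 2 = Real.sqrt σ * π + Real.sqrt σ * x / 2 by ring,
      Real.exp_add]
    ring
  · rw [hψ₂, hψ₂, hFper, hcosper,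
      show -(Real.sqrt σ * (x + 2 * π) / 2) = -(Real.sqrt σ * π) + -(Real.sqrt σ * x / 2) by ring,
      Real.exp_add]
    ring
  · have hu : ∀ x, HasDerivAt (fun y : ℝ => 1 + a * Real.cos (n * y / 2) * Real.sin (n * y / 2))
        (n / 2 * a * (Real.cos (n * x / 2) ^ 2 - Real.sin (n * x / 2) ^ 2)) x := fun x => by
      refine ((((hc x).const_mul a).mul (hS x)).const_add 1).congr_deriv ?_
      ring
    have hv : ∀ x, HasDerivAt (fun y : ℝ => a * Real.cos (n * y / 2) ^ 2)
        (-(n * a * Real.cos (n * x / 2) * Real.sin (n * x / 2))) x := fun x => by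
      refine (((hc x).pow 2).const_mul a).congr_deriv ?_
      simp; ring
    have hslit : ∀ x : ℝ,
        (((1 + a * Real.cos (n * x / 2) * Real.sin (n * x / 2) : ℝ) : ℂ) +
        ((a * Real.cos (n * x / 2) ^ 2 : ℝ) : ℂ) * Complex.I) ∈ Complex.slitPlane := fun x => by
      rw [Complex.mem_slitPlane_iff]
      simp only [Complex.add_re, Complex.add_im, Complex.ofReal_re, Complex.ofReal_im,
        Complex.re_ofReal_mul, Complex.im_ofReal_mul, Complex.I_re, Complex.I_im]
      rcases eq_or_ne (Real.cos (n * x / 2)) 0 with h | h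
      · left; simp [h]
      · right; simp [h, ha0.ne']
    have hΦ : ∀ x, HasDerivAt (fun y => (3 * σ / 2 - n ^ 2) * y - 3 * n / 2 * (2 / n *
        ((n * (a * (Real.cos (n * y / 2) ^ 2 - Real.sin (n * y / 2) ^ 2)
          - a ^ 2 * Real.cos (n * y / 2) * Real.sin (n * y / 2))) / F y)) +
        (σ / 2 - n ^ 2) * (2 / n) *
          (Complex.log (((1 + a * Real.cos (n * y / 2) * Real.sin (n * y / 2) : ℝ) : ℂ) +
            ((a * Real.cos (n * y / 2) ^ 2 : ℝ) : ℂ) * Complex.I)).im) (μn x) x := fun x => by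
      have hne := (hpos x).ne'
      refine ((((hasDerivAt_id x).const_mul (3 * σ / 2 - (n : ℝ) ^ 2)).sub
        ((((hF2 x).div (hF1 x) hne).const_mul (2 / (n : ℝ))).const_mul (3 * n / 2 : ℝ))).add
        ((hasDerivAt_im_log (hu x) (hv x) (hslit x)).const_mul
          ((σ / 2 - (n : ℝ) ^ 2) * (2 / n)))).congr_deriv ?_
      have h := hcs x
      have hmod : (1 + a * Real.cos (n * x / 2) * Real.sin (n * x / 2)) ^ 2 +
          (a * Real.cos (n * x / 2) ^ 2) ^ 2 = F x := by
        rw [hF]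
        generalize Real.cos (n * x / 2) = c at *
        generalize Real.sin (n * x / 2) = S at *
        linear_combination (a ^ 2 * c ^ 2 - 1) * h
      have hnum : -(n * a * Real.cos (n * x / 2) * Real.sin (n * x / 2)) *
          (1 + a * Real.cos (n * x / 2) * Real.sin (n * x / 2)) -
          n / 2 * a * (Real.cos (n * x / 2) ^ 2 - Real.sin (n * x / 2) ^ 2) *
          (a * Real.cos (n * x / 2) ^ 2) = n / 2 * (1 - F x) := by
        rw [hF, angular_identity (hcs x)]
      rw [hmod, hnum, ← sq, hF1sq, hμn, hσa]
      field_simp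
      ring
    rw [intervalIntegral.integral_eq_sub_of_hasDerivAt (fun x _ => hΦ x)
      (hμsmooth.continuous.intervalIntegrable _ _)]
    have e1 := hcosper 0
    have e2 := hsinper 0
    have e3 := hFper 0
    rw [zero_add] at e1 e2 e3
    rw [e1, e2, e3]
    simp only [mul_pow, hsign, mul_zero, zero_div, Real.sin_zero, Real.cos_zero]
    simp
    field_simp
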